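/- Let f = b_0 + Σ_{j=1}^{n} b_j·X^{α(j)} + Σ_{i=1}^{k} a_i·X^{y(i)} be as in the context. Suppose f is nonnegative on ℝⁿ and there exists v ∈ (ℝ \ {0})ⁿ such that a_i·v^{y(i)} < 0 for all 1 ≤ i ≤ k. Then f is a sum of nonnegative circuit polynomials: there exist polynomials E_1,…,E_k, each nonnegative on ℝⁿ and each of the form E_i = c_{i,0} + Σ_{j=1}^{n} c_{i,j}·X^{α(j)} + a_i·X^{y(i)} with c_{i,0},…,c_{i,n} ≥ 0, and nonnegative reals d_0,…,d_n, such that f = Σ_{i=1}^{k} E_i + d_0 + Σ_{j=1}^{n} d_j·X^{α(j)}. -/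

import Mathlib

open MvPolynomial

/-- The function `s ↦ ∑ i, A i * ∏ j, s j ^ L i j` is homogeneous of degree one when the rows
of `L` sum to one. -/
lemma sum_mul_prod_rpow_smul {ι κ : Type*} [Fintype ι] [Fintype κ] (A : κ → ℝ) (L : κ → ι → ℝ)
    (hL : ∀ i, ∑ j, L i j = 1) {t : ℝ} (ht : 0 < t) {s : ι → ℝ} (hs : ∀ j, 0 ≤ s j) :
    ∑ i, A i * ∏ j, (t * s j) ^ L i j = t * ∑ i, A i * ∏ j, s j ^ L i j := by
  rw [Finset.mul_sum]
  refine Finset.sum_congr rfl fun i _ => ?_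
  have h : ∏ j, (t * s j) ^ L i j = t * ∏ j, s j ^ L i j := by
    rw [Finset.prod_congr rfl fun j _ => Real.mul_rpow ht.le (hs j), Finset.prod_mul_distrib,
      ← Real.rpow_sum_of_pos ht, hL, Real.rpow_one]
  rw [h]
  ring

/-- If a weighted sum of weighted geometric means is bounded by a positive linear form on the
positive orthant, the best constant in this bound is attained at a positive point. -/
lemma exists_pos_tight_point {ι κ : Type*} [Fintype ι] [Nonempty ι] [Fintype κ] [Nonempty κ]
    (b : ι → ℝ) (hb : ∀ j, 0 < b j) (A : κ → ℝ) (hA : ∀ i, 0 < A i)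
    (L : κ → ι → ℝ) (hL : ∀ i j, 0 < L i j) (hLsum : ∀ i, ∑ j, L i j = 1)
    (h : ∀ s : ι → ℝ, (∀ j, 0 < s j) → ∑ i, A i * ∏ j, s j ^ L i j ≤ ∑ j, b j * s j) :
    ∃ (p : ι → ℝ) (M : ℝ), (∀ j, 0 < p j) ∧ M ≤ 1 ∧
      ∑ i, A i * ∏ j, p j ^ L i j = M * ∑ j, b j * p j ∧
      ∀ s : ι → ℝ, (∀ j, 0 < s j) → ∑ i, A i * ∏ j, s j ^ L i j ≤ M * ∑ j, b j * s j := by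
  have hbpos : ∀ s ∈ stdSimplex ℝ ι, 0 < ∑ j, b j * s j := by
    intro s hs
    obtain ⟨j, -, hj⟩ : ∃ j ∈ Finset.univ, 0 < s j := by
      apply Finset.exists_lt_of_sum_lt (f := fun _ => (0 : ℝ))
      simp [hs.2]
    exact Finset.sum_pos' (fun j _ => mul_nonneg (hb j).le (hs.1 j))
      ⟨j, Finset.mem_univ j, mul_pos (hb j) hj⟩
  have hcont : ContinuousOn
      (fun s : ι → ℝ => (∑ i, A i * ∏ j, s j ^ L i j) / ∑ j, b j * s j) (stdSimplex ℝ ι) := by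
    apply ContinuousOn.div
    · apply Continuous.continuousOn
      refine continuous_finsetSum _ fun i _ => continuous_const.mul ?_
      exact continuous_finsetProd _ fun j _ =>
        (continuous_apply j).rpow_const fun _ => Or.inr (hL i j).le
    · fun_prop
    · exact fun s hs => (hbpos s hs).ne'
  have hnormalize : ∀ s : ι → ℝ, (∀ j, 0 < s j) →
      (fun j => (∑ j, s j)⁻¹ * s j) ∈ stdSimplex ℝ ι := by
    intro s hs
    have hsum : 0 < ∑ j, s j := Finset.sum_pos (fun j _ => hs j) Finset.univ_nonempty
    refine ⟨fun j => mul_nonneg (inv_nonneg.2 hsum.le) (hs j).le, ?_⟩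
    rw [← Finset.mul_sum, inv_mul_cancel₀ hsum.ne']
  obtain ⟨p, hp, hmax⟩ := (isCompact_stdSimplex (𝕜 := ℝ) ι).exists_isMaxOn
    ⟨_, hnormalize (fun _ => 1) fun _ => one_pos⟩ hcont
  have hle : ∀ s : ι → ℝ, (∀ j, 0 < s j) → (∑ i, A i * ∏ j, s j ^ L i j) / (∑ j, b j * s j) ≤
      (∑ i, A i * ∏ j, p j ^ L i j) / ∑ j, b j * p j := by
    intro s hs
    have hsum : 0 < ∑ j, s j := Finset.sum_pos (fun j _ => hs j) Finset.univ_nonempty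
    have h1 := hmax (hnormalize s hs)
    simp only [Set.mem_ofPred_eq] at h1
    rw [sum_mul_prod_rpow_smul A L hLsum (inv_pos.2 hsum) fun j => (hs j).le,
      Finset.sum_congr rfl fun j _ => mul_left_comm (b j) _ (s j), ← Finset.mul_sum,
      mul_div_mul_left _ _ (inv_pos.2 hsum).ne'] at h1
    exact h1
  have hppos : ∀ j, 0 < p j := by
    intro j
    refine (hp.1 j).lt_of_ne' fun hj => ?_
    have h1 := hle (fun _ => 1) fun _ => one_pos
    have h2 : ∑ i, A i * ∏ j, p j ^ L i j = 0 := by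
      refine Finset.sum_eq_zero fun i _ => ?_
      rw [Finset.prod_eq_zero (Finset.mem_univ j), mul_zero]
      rw [hj, Real.zero_rpow (hL i j).ne']
    rw [h2, zero_div] at h1
    refine h1.not_gt (div_pos ?_ ?_)
    · exact Finset.sum_pos (fun i _ => by simpa using hA i) Finset.univ_nonempty
    · exact Finset.sum_pos (fun j _ => by simpa using hb j) Finset.univ_nonempty
  refine ⟨p, (∑ i, A i * ∏ j, p j ^ L i j) / ∑ j, b j * p j, hppos, ?_, ?_, ?_⟩
  · rw [div_le_one (hbpos p hp)]
    exact h p hppos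
  · rw [div_mul_cancel₀ _ (hbpos p hp).ne']
  · intro s hs
    have hbs : 0 < ∑ j, b j * s j :=
      Finset.sum_pos (fun j _ => mul_pos (hb j) (hs j)) Finset.univ_nonempty
    exact (div_le_iff₀ hbs).1 (hle s hs)

/-- First-order optimality condition at a positive point where a weighted sum of weighted
geometric means touches a linear form from below. -/
lemma sum_mul_exponent_eq_of_tight {ι κ : Type*} [Fintype ι] [Fintype κ]
    (b : ι → ℝ) (A : κ → ℝ) (L : κ → ι → ℝ) {p : ι → ℝ} (hp : ∀ j, 0 < p j)
    (heq : ∑ i, A i * ∏ j, p j ^ L i j = ∑ j, b j * p j)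
    (hle : ∀ s : ι → ℝ, (∀ j, 0 < s j) → ∑ i, A i * ∏ j, s j ^ L i j ≤ ∑ j, b j * s j)
    (j : ι) : ∑ i, A i * (∏ j, p j ^ L i j) * L i j = b j * p j := by
  classical
  let g : ℝ → ℝ := fun t => ∑ i, A i * (∏ j, p j ^ L i j) * t ^ L i j - b j * p j * t
  have hg : ∀ t, 0 < t → g t ≤ g 1 := by
    intro t ht
    have h1 := hle (fun m => p m * if m = j then t else 1) fun m => by
      have := hp m
      split_ifs <;> positivity
    have h2 : ∀ i, ∏ m, (p m * if m = j then t else 1) ^ L i m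
        = (∏ m, p m ^ L i m) * t ^ L i j := by
      intro i
      have h3 : ∏ m, (if m = j then t else 1) ^ L i m = t ^ L i j := by
        rw [Finset.prod_eq_single j]
        · simp
        · intro m _ hm
          simp [hm]
        · simp
      rw [← h3, ← Finset.prod_mul_distrib]
      refine Finset.prod_congr rfl fun m _ => Real.mul_rpow (hp m).le ?_
      split_ifs <;> positivity
    have h4 : ∑ m, b m * (p m * if m = j then t else 1)
        = ∑ m, b m * p m + b j * p j * (t - 1) := by
      have h5 : ∀ m, b m * (p m * if m = j then t else 1)
          = b m * p m + if m = j then b j * p j * (t - 1) else 0 := by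
        intro m
        split_ifs with hm
        · subst hm; ring
        · ring
      rw [Finset.sum_congr rfl fun m _ => h5 m, Finset.sum_add_distrib]
      simp
    simp only [h2] at h1
    rw [h4] at h1
    simp only [g, Real.one_rpow, mul_one]
    rw [heq]
    simp only [mul_assoc] at h1 ⊢
    linarith
  have hmax : IsLocalMax g 1 := by
    filter_upwards [lt_mem_nhds (zero_lt_one' ℝ)] with t ht using hg t ht
  have hderiv : HasDerivAt g (∑ i, A i * (∏ j, p j ^ L i j) * L i j - b j * p j) 1 := by
    refine HasDerivAt.sub (HasDerivAt.fun_sum fun i _ => ?_) ?_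
    · simpa using (Real.hasDerivAt_rpow_const (x := 1) (p := L i j)
        (Or.inl one_ne_zero)).const_mul (A i * ∏ j, p j ^ L i j)
    · simpa using (hasDerivAt_id (1 : ℝ)).const_mul (b j * p j)
  exact sub_eq_zero.1 (hmax.hasDerivAt_eq_zero hderiv)

/-- If a weighted sum of weighted geometric means is bounded by a positive linear form, then the
linear form can be split so that each part bounds the corresponding geometric mean. -/
lemma exists_split_of_sum_geom_mean_le {ι κ : Type*} [Fintype ι] [Nonempty ι] [Fintype κ]
    [Nonempty κ]
    (b : ι → ℝ) (hb : ∀ j, 0 < b j) (A : κ → ℝ) (hA : ∀ i, 0 < A i)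
    (L : κ → ι → ℝ) (hL : ∀ i j, 0 < L i j) (hLsum : ∀ i, ∑ j, L i j = 1)
    (h : ∀ s : ι → ℝ, (∀ j, 0 < s j) → ∑ i, A i * ∏ j, s j ^ L i j ≤ ∑ j, b j * s j) :
    ∃ c : κ → ι → ℝ, (∀ i j, 0 ≤ c i j) ∧ (∀ j, ∑ i, c i j ≤ b j) ∧
      ∀ i, ∀ s : ι → ℝ, (∀ j, 0 ≤ s j) → A i * ∏ j, s j ^ L i j ≤ ∑ j, c i j * s j := by
  obtain ⟨p, M, hp, hM, heq, hle⟩ := exists_pos_tight_point b hb A hA L hL hLsum h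
  simp only [Finset.mul_sum, ← mul_assoc] at heq hle
  have hcrit := sum_mul_exponent_eq_of_tight (fun j => M * b j) A L hp heq hle
  have hprod : ∀ i, 0 < ∏ j, p j ^ L i j := fun i =>
    Finset.prod_pos fun j _ => Real.rpow_pos_of_pos (hp j) _
  refine ⟨fun i j => A i * (∏ j, p j ^ L i j) * L i j / p j, fun i j => ?_, fun j => ?_,
    fun i s hs => ?_⟩
  · have := hA i
    have := hprod i
    have := hL i j
    have := hp j
    positivity
  · rw [← Finset.sum_div, hcrit j, mul_div_cancel_right₀ _ (hp j).ne']
    exact mul_le_of_le_one_left (hb j).le hM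
  · have hq : ∀ j, 0 ≤ s j / p j := fun j => div_nonneg (hs j) (hp j).le
    have hamgm := Real.geom_mean_le_arith_mean_weighted Finset.univ (L i) (fun j => s j / p j)
      (fun j _ => (hL i j).le) (hLsum i) fun j _ => hq j
    have hs' : ∏ j, s j ^ L i j = (∏ j, p j ^ L i j) * ∏ j, (s j / p j) ^ L i j := by
      rw [← Finset.prod_mul_distrib]
      refine Finset.prod_congr rfl fun j _ => ?_
      rw [← Real.mul_rpow (hp j).le (hq j), mul_div_cancel₀ _ (hp j).ne']
    calc A i * ∏ j, s j ^ L i j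
        = A i * (∏ j, p j ^ L i j) * ∏ j, (s j / p j) ^ L i j := by rw [hs', mul_assoc]
      _ ≤ A i * (∏ j, p j ^ L i j) * ∑ j, L i j * (s j / p j) :=
        mul_le_mul_of_nonneg_left hamgm (mul_pos (hA i) (hprod i)).le
      _ = ∑ j, A i * (∏ j, p j ^ L i j) * L i j / p j * s j := by
        rw [Finset.mul_sum]
        exact Finset.sum_congr rfl fun j _ => by ring

/-- Monomials whose exponent is a convex combination are weighted geometric means. -/
lemma prod_rpow_prod_pow_eq {ι σ : Type*} [Fintype ι] [Fintype σ] (α : ι → σ → ℕ) (y : σ → ℕ)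
    (w : ι → ℝ) (hw : ∀ j, 0 ≤ w j) (hy : ∀ l, (y l : ℝ) = ∑ j, w j * (α j l : ℝ))
    (z : σ → ℝ) (hz : ∀ l, 0 ≤ z l) :
    ∏ j, (∏ l, z l ^ α j l) ^ w j = ∏ l, z l ^ y l := by
  have h1 : ∀ j, (∏ l, z l ^ α j l) ^ w j = ∏ l, z l ^ (w j * (α j l : ℝ)) := by
    intro j
    rw [← Real.finsetProd_rpow _ _ fun l _ => pow_nonneg (hz l) _]
    refine Finset.prod_congr rfl fun l _ => ?_
    rw [← Real.rpow_natCast, ← Real.rpow_mul (hz l), mul_comm]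
  simp only [h1]
  rw [Finset.prod_comm]
  refine Finset.prod_congr rfl fun l _ => ?_
  rw [← Real.rpow_sum_of_nonneg (hz l) fun j _ => mul_nonneg (hw j) (Nat.cast_nonneg _), ← hy,
    Real.rpow_natCast]

/-- Linearly independent exponent vectors give a monomial map that is surjective on the positive
orthant. -/
lemma exists_pos_prod_pow_eq {n : ℕ} (α : Fin n → Fin n → ℕ)
    (hlin : LinearIndependent ℝ (fun j : Fin n => (fun i : Fin n => (α j i : ℝ))))
    (r : Fin n → ℝ) (hr : ∀ j, 0 < r j) :
    ∃ z : Fin n → ℝ, (∀ l, 0 < z l) ∧ ∀ j, ∏ l, z l ^ α j l = r j := by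
  let N : Matrix (Fin n) (Fin n) ℝ := fun j i => (α j i : ℝ)
  have hN : IsUnit N := Matrix.linearIndependent_rows_iff_isUnit.1 hlin
  obtain ⟨w, hw⟩ := Matrix.mulVec_surjective_iff_isUnit.2 hN fun j => Real.log (r j)
  refine ⟨fun l => Real.exp (w l), fun l => Real.exp_pos _, fun j => ?_⟩
  simp only [← Real.exp_nat_mul, ← Real.exp_sum]
  have h1 : ∑ l, (α j l : ℝ) * w l = Real.log (r j) := congrFun hw j
  rw [h1, Real.exp_log (hr j)]

/-- If a real times a monomial value is negative, then replacing the point by the signs of its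
coordinates gives minus the absolute value of the coefficient. -/
lemma mul_prod_sign_pow_eq_neg_abs {σ : Type*} [Fintype σ] {a : ℝ} {v : σ → ℝ}
    (hv : ∀ l, v l ≠ 0) {y : σ → ℕ} (h : a * ∏ l, v l ^ y l < 0) :
    a * ∏ l, (SignType.sign (v l) : ℝ) ^ y l = -|a| := by
  have hv' : ∏ l, v l ^ y l = (∏ l, (SignType.sign (v l) : ℝ) ^ y l) * ∏ l, |v l| ^ y l := by
    rw [← Finset.prod_mul_distrib]
    refine Finset.prod_congr rfl fun l _ => ?_
    rw [← mul_pow, sign_mul_abs]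
  have hpos : 0 < ∏ l, |v l| ^ y l :=
    Finset.prod_pos fun l _ => pow_pos (abs_pos.2 (hv l)) _
  have habs : |∏ l, (SignType.sign (v l) : ℝ) ^ y l| = 1 := by
    rw [Finset.abs_prod]
    refine Finset.prod_eq_one fun l _ => ?_
    rw [abs_pow]
    rcases (hv l).lt_or_gt with hl | hl <;> simp [hl]
  rw [hv', ← mul_assoc] at h
  have hneg := neg_of_mul_neg_left h hpos.le
  rw [← neg_eq_iff_eq_neg, ← abs_of_neg hneg, abs_mul, habs, mul_one]

/-- Let `f = b₀ + Σ_j b_j X^{α(j)} + Σ_i a_i X^{y(i)}` with simplex Newton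
polytope (even vertices `0, α(1),…,α(n)`), interior lattice exponents `y(i)`, and nonzero
coefficients `a_i`. If `f` is nonnegative and there exists `v ∈ (ℝ∖{0})ⁿ` with
`a_i v^{y(i)} < 0` for all `i`, then `f` is a sum of nonnegative circuit polynomials (plus a
sum of monomial squares). -/
theorem simplex_poly_sonc_of_negative_orthant
    (n k : ℕ) (hn : 1 ≤ n) (hk : 1 ≤ k)
    (α : Fin n → Fin n → ℕ)
    (hαeven : ∀ j i, Even (α j i))
    (hlin : LinearIndependent ℝ (fun j : Fin n => (fun i : Fin n => (α j i : ℝ))))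
    (b₀ : ℝ) (hb₀ : 0 < b₀)
    (b : Fin n → ℝ) (hb : ∀ j, 0 < b j)
    (a : Fin k → ℝ) (ha : ∀ i, a i ≠ 0)
    (y : Fin k → Fin n → ℕ) (hydist : Function.Injective y)
    (lam₀ : Fin k → ℝ) (lam : Fin k → Fin n → ℝ)
    (hlam₀ : ∀ i, 0 < lam₀ i) (hlam : ∀ i j, 0 < lam i j)
    (hlamsum : ∀ i, lam₀ i + ∑ j, lam i j = 1)
    (hy : ∀ i l, (y i l : ℝ) = ∑ j, lam i j * (α j l : ℝ))
    (f : MvPolynomial (Fin n) ℝ)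
    (hf : f = C b₀ + ∑ j, C (b j) * ∏ l, X l ^ α j l
        + ∑ i, C (a i) * ∏ l, X l ^ y i l)
    (hnonneg : ∀ x : Fin n → ℝ, 0 ≤ eval x f)
    (v : Fin n → ℝ) (hv : ∀ l, v l ≠ 0)
    (hva : ∀ i, a i * ∏ l, v l ^ y i l < 0) :
    ∃ (E : Fin k → MvPolynomial (Fin n) ℝ) (d₀ : ℝ) (dd : Fin n → ℝ),
      (∀ i, ∃ (c₀ : ℝ) (cc : Fin n → ℝ), 0 ≤ c₀ ∧ (∀ j, 0 ≤ cc j) ∧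
        E i = C c₀ + ∑ j, C (cc j) * ∏ l, X l ^ α j l
          + C (a i) * ∏ l, X l ^ y i l) ∧
      (∀ i, ∀ x : Fin n → ℝ, 0 ≤ eval x (E i)) ∧
      0 ≤ d₀ ∧ (∀ j, 0 ≤ dd j) ∧
      f = ∑ i, E i + C d₀ + ∑ j, C (dd j) * ∏ l, X l ^ α j l := by
  have : Nonempty (Fin k) := ⟨⟨0, hk⟩⟩
  have heven : ∀ (x : Fin n → ℝ) j, ∏ l, |x l| ^ α j l = ∏ l, x l ^ α j l := fun x j =>
    Finset.prod_congr rfl fun l _ => (hαeven j l).pow_abs (x l)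
  have hmean : ∀ (z : Fin n → ℝ), (∀ l, 0 ≤ z l) → ∀ i,
      ∏ j, (∏ l, z l ^ α j l) ^ lam i j = ∏ l, z l ^ y i l := fun z hz i =>
    prod_rpow_prod_pow_eq α (y i) (lam i) (fun j => (hlam i j).le) (hy i) z hz
  have hbound : ∀ z : Fin n → ℝ, (∀ l, 0 < z l) →
      ∑ i, |a i| * ∏ l, z l ^ y i l ≤ b₀ + ∑ j, b j * ∏ l, z l ^ α j l := by
    intro z hz
    have habs : ∀ l, |(SignType.sign (v l) : ℝ) * z l| = z l := by
      intro l
      rcases (hv l).lt_or_gt with hl | hl <;> simp [hl, abs_of_pos (hz l)]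
    have h := hnonneg fun l => (SignType.sign (v l) : ℝ) * z l
    simp only [hf, map_add, map_sum, map_mul, map_prod, map_pow, eval_C, eval_X] at h
    simp only [← heven (fun l => (SignType.sign (v l) : ℝ) * z l), habs] at h
    simp only [mul_pow, Finset.prod_mul_distrib, ← mul_assoc,
      fun i => mul_prod_sign_pow_eq_neg_abs hv (hva i), neg_mul, Finset.sum_neg_distrib] at h
    linarith
  have hhom : ∀ s : Option (Fin n) → ℝ, (∀ j, 0 < s j) →
      ∑ i, |a i| * ∏ j, s j ^ (fun j : Option (Fin n) => j.elim (lam₀ i) (lam i)) j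
        ≤ ∑ j, (fun j : Option (Fin n) => j.elim b₀ b) j * s j := by
    intro s hs
    obtain ⟨z, hz, hzs⟩ := exists_pos_prod_pow_eq α hlin (fun j => (s none)⁻¹ * s (some j))
      fun j => mul_pos (inv_pos.2 (hs none)) (hs (some j))
    have h := hbound z hz
    simp only [← hmean z fun l => (hz l).le, hzs] at h
    have h1 := sum_mul_prod_rpow_smul (fun i => |a i|)
      (fun i (j : Option (Fin n)) => j.elim (lam₀ i) (lam i))
      (fun i => by simpa [Fintype.sum_option] using hlamsum i) (inv_pos.2 (hs none))
      fun j => (hs j).le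
    have h2 : ∑ i, |a i| * ∏ j, ((s none)⁻¹ * s (some j)) ^ lam i j
        = (s none)⁻¹ * ∑ i, |a i| * ∏ j, s j ^ (j.elim (lam₀ i) (lam i)) := by
      rw [← h1]
      simp [Fintype.prod_option, inv_mul_cancel₀ (hs none).ne']
    rw [h2, inv_mul_le_iff₀ (hs none), mul_add, Finset.mul_sum] at h
    refine h.trans_eq ?_
    rw [Fintype.sum_option]
    have h0 := (hs none).ne'
    simp only [Option.elim_none, Option.elim_some, mul_comm (s none) b₀]
    congr 1
    refine Finset.sum_congr rfl fun j _ => ?_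
    field_simp
  obtain ⟨c, hc, hcb, hcE⟩ := exists_split_of_sum_geom_mean_le
    (fun j : Option (Fin n) => j.elim b₀ b) (by rintro (_ | j); exacts [hb₀, hb j])
    (fun i => |a i|) (fun i => abs_pos.2 (ha i))
    (fun i (j : Option (Fin n)) => j.elim (lam₀ i) (lam i))
    (by rintro i (_ | j); exacts [hlam₀ i, hlam i j])
    (fun i => by simpa [Fintype.sum_option] using hlamsum i) hhom
  refine ⟨fun i => C (c i none) + ∑ j, C (c i (some j)) * ∏ l, X l ^ α j l
      + C (a i) * ∏ l, X l ^ y i l, b₀ - ∑ i, c i none, fun j => b j - ∑ i, c i (some j),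
    fun i => ⟨c i none, fun j => c i (some j), hc i none, fun j => hc i (some j), rfl⟩,
    fun i x => ?_, sub_nonneg.2 (hcb none), fun j => sub_nonneg.2 (hcb (some j)), ?_⟩
  · have h := hcE i (fun j => j.elim 1 fun j => ∏ l, |x l| ^ α j l) (by
      rintro (_ | j)
      · exact zero_le_one
      · exact Finset.prod_nonneg fun l _ => pow_nonneg (abs_nonneg _) _)
    simp only [Fintype.sum_option, Fintype.prod_option, Option.elim_none, Option.elim_some,
      Real.one_rpow, one_mul, mul_one, hmean _ fun l => abs_nonneg (x l)] at h
    simp only [heven] at h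
    have h1 := neg_abs_le (a i * ∏ l, x l ^ y i l)
    rw [abs_mul, Finset.abs_prod] at h1
    simp only [abs_pow] at h1
    simp only [map_add, map_sum, map_mul, map_prod, map_pow, eval_C, eval_X]
    linarith
  · rw [hf]
    simp only [Finset.sum_add_distrib, map_sub, map_sum, sub_mul, Finset.sum_sub_distrib,
      Finset.sum_mul]
    rw [Finset.sum_comm (s := (Finset.univ : Finset (Fin k)))]
    ring
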